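/- Let Ĝ^d be a swap-maximal loopy graph whose largest clique K^0 contained in V^0 has exactly d vertices, with d ≥ 2. Then for every u ∈ K^0 and every x ∈ V^0, deg(u) ≥ deg(x). -/

import Mathlib

open scoped Classical

/-- A loopy graph: at most one edge between any two distinct vertices and at most one
self-loop at each vertex, encoded as a symmetric adjacency relation. -/
structure LoopyGraph (V : Type) where
  Adj : V → V → Prop
  symm : ∀ u v : V, Adj u v → Adj v u

namespace LoopyGraph

variable {V : Type}

/-- The neighbors of `u` (vertices other than `u` adjacent to `u`). -/
def nbr (G : LoopyGraph V) (u : V) : Set V := {v | v ≠ u ∧ G.Adj u v}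

/-- Degree of a vertex: each self-loop contributes `2`. -/
noncomputable def deg (G : LoopyGraph V) (u : V) : ℕ :=
  (G.nbr u).ncard + (if G.Adj u u then 2 else 0)

/-- `G₂` is obtained from `G₁` by a single valid double edge swap
`(u,v),(x,y) ⤳ (u,x),(v,y)`: the two removed edges are distinct edges of `G₁`, the two
added edges are distinct and not already present (no multiedge and no doubled
self-loop is created). -/
def DoubleEdgeSwap (G₁ G₂ : LoopyGraph V) : Prop :=
  ∃ u v x y : V,
    G₁.Adj u v ∧ G₁.Adj x y ∧
    s(u, v) ≠ s(x, y) ∧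
    ¬ G₁.Adj u x ∧ ¬ G₁.Adj v y ∧ s(u, x) ≠ s(v, y) ∧
    ∀ a b : V, G₂.Adj a b ↔
      ((G₁.Adj a b ∧ s(a, b) ≠ s(u, v) ∧ s(a, b) ≠ s(x, y)) ∨
        s(a, b) = s(u, x) ∨ s(a, b) = s(v, y))

/-- `G₂` is reachable from `G₁` by a finite sequence of valid double edge swaps. -/
def Reach (G₁ G₂ : LoopyGraph V) : Prop :=
  Relation.ReflTransGen DoubleEdgeSwap G₁ G₂

/-- Vertices at (shortest-path) distance at most `k` from the set of loop-free vertices. -/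
def within (G : LoopyGraph V) : ℕ → Set V
  | 0 => {v | ¬ G.Adj v v}
  | (k + 1) => within G k ∪ {v | ∃ u ∈ within G k, G.Adj v u}

/-- `Vset G 0 = V^0` is the set of vertices with no self-loop; for `k ≥ 1`,
`Vset G k = V^k` is the set of vertices (necessarily carrying a self-loop) whose
shortest-path distance to `V^0` is exactly `k`. -/
def Vset (G : LoopyGraph V) : ℕ → Set V
  | 0 => {v | ¬ G.Adj v v}
  | (k + 1) => within G (k + 1) \ within G k

/-- `V^∞`: vertices (with a self-loop) having no path to `V^0`. -/
def Vinf (G : LoopyGraph V) : Set V := {v | ∀ k : ℕ, v ∉ within G k}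

/-- A set of vertices is a clique when all pairs of distinct members are adjacent. -/
def IsClique (G : LoopyGraph V) (s : Set V) : Prop :=
  ∀ x ∈ s, ∀ y ∈ s, x ≠ y → G.Adj x y

/-- The set of vertices carrying a self-loop. -/
def selfLoops (G : LoopyGraph V) : Set V := {v | G.Adj v v}

/-- The edges of `G` with both endpoints in `V^0`. -/
def V0edges (G : LoopyGraph V) : Set (Sym2 V) :=
  {e | ∃ u v : V, e = s(u, v) ∧ G.Adj u v ∧ u ∈ Vset G 0 ∧ v ∈ Vset G 0}

/-- `Ĝ` is swap-maximal: among all loopy graphs reachable from it by double edge swaps it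
has the maximum number of self-loops, and subject to that the maximum number of edges with
both endpoints in `V^0`. -/
def SwapMaximal (G : LoopyGraph V) : Prop :=
  ∀ H : LoopyGraph V, Reach G H →
    (selfLoops H).ncard ≤ (selfLoops G).ncard ∧
      ((selfLoops H).ncard = (selfLoops G).ncard →
        (V0edges H).ncard ≤ (V0edges G).ncard)

/-- `K` is a largest clique contained in `V^0`, and it has exactly `d` vertices. -/
def LargestV0Clique (G : LoopyGraph V) (K : Set V) (d : ℕ) : Prop :=
  K ⊆ Vset G 0 ∧ IsClique G K ∧ K.ncard = d ∧
    ∀ K' : Set V, K' ⊆ Vset G 0 → IsClique G K' → K'.ncard ≤ d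

/-- Class `Q1`. -/
def Q1 (G : LoopyGraph V) : Prop :=
  ∃ K : Set V, K ⊆ Vset G 0 ∧ 4 ≤ K.ncard ∧ IsClique G K ∧
    (∀ u ∈ Vset G 0, (∀ w ∈ Vset G 0, ¬ G.Adj u w) ∨ u ∈ K) ∧
    IsClique G (Vset G 1 ∪ K) ∧
    Vset G 2 = ∅ ∧ Vinf G = ∅

/-- Class `Q2`. -/
def Q2 (G : LoopyGraph V) : Prop :=
  3 ≤ {u | u ∈ Vset G 0 ∧ (nbr G u ∩ Vset G 0).ncard = 2}.ncard ∧
  (∀ u ∈ Vset G 0,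
      (∀ w ∈ Vset G 0, ¬ G.Adj u w) ∨
        ((nbr G u ∩ Vset G 0).ncard = 2 ∧ ∀ w ∈ Vset G 1, G.Adj u w)) ∧
  IsClique G (Vset G 1) ∧
  (∀ u ∈ Vset G 2, nbr G u = Vset G 1) ∧
  Vset G 3 = ∅ ∧
  (Vinf G = ∅ ∨ (Vset G 1 = ∅ ∧ ∀ u ∈ Vinf G, deg G u = 2))

/-- The graph of loopy graphs `𝒢({k_i})` is connected: any two loopy graphs with degree
sequence `k` are linked by a finite sequence of valid double edge swaps. -/
def GConnected (k : V → ℕ) : Prop :=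
  ∀ G₁ G₂ : LoopyGraph V, (∀ v, deg G₁ v = k v) → (∀ v, deg G₂ v = k v) →
    Reach G₁ G₂

/-- `G₂` is obtained from `G₁` by a single valid triangle-loop swap: either a triangle on
three distinct vertices is replaced by three self-loops, or conversely. -/
def TriangleLoopSwap (G₁ G₂ : LoopyGraph V) : Prop :=
  ∃ u v w : V, u ≠ v ∧ v ≠ w ∧ u ≠ w ∧
    ((G₁.Adj u v ∧ G₁.Adj v w ∧ G₁.Adj w u ∧
        ¬ G₁.Adj u u ∧ ¬ G₁.Adj v v ∧ ¬ G₁.Adj w w ∧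
        ∀ a b : V, G₂.Adj a b ↔
          ((G₁.Adj a b ∧ s(a, b) ≠ s(u, v) ∧ s(a, b) ≠ s(v, w) ∧ s(a, b) ≠ s(w, u)) ∨
            s(a, b) = s(u, u) ∨ s(a, b) = s(v, v) ∨ s(a, b) = s(w, w))) ∨
      (G₁.Adj u u ∧ G₁.Adj v v ∧ G₁.Adj w w ∧
        ¬ G₁.Adj u v ∧ ¬ G₁.Adj v w ∧ ¬ G₁.Adj w u ∧
        ∀ a b : V, G₂.Adj a b ↔
          ((G₁.Adj a b ∧ s(a, b) ≠ s(u, u) ∧ s(a, b) ≠ s(v, v) ∧ s(a, b) ≠ s(w, w)) ∨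
            s(a, b) = s(u, v) ∨ s(a, b) = s(v, w) ∨ s(a, b) = s(w, u))))

/-- Reachability in the augmented graph of loopy graphs `𝒢_△`: a finite sequence of moves,
each a valid double edge swap or a valid triangle-loop swap. -/
def ReachTri (G₁ G₂ : LoopyGraph V) : Prop :=
  Relation.ReflTransGen
    (fun H₁ H₂ => DoubleEdgeSwap H₁ H₂ ∨ TriangleLoopSwap H₁ H₂) G₁ G₂

/-- `S` is a set of highest-degree vertices for the degree sequence `k`. -/
def TopSet (k : V → ℕ) (S : Set V) : Prop :=
  ∀ u ∈ S, ∀ v : V, v ∉ S → k v ≤ k u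

/-- A loopy graph is simple when it has no self-loops. -/
def IsSimple (G : LoopyGraph V) : Prop := ∀ v : V, ¬ G.Adj v v

/-- `k` is the degree sequence of some simple graph. -/
def SimpleGraphical (k : V → ℕ) : Prop :=
  ∃ G : LoopyGraph V, IsSimple G ∧ ∀ v, deg G v = k v

/-- `k` is `m`-simple-graphical: subtracting `2` from each of the `m` largest entries
yields a simple-graphical sequence. -/
def MSimpleGraphical (k : V → ℕ) (m : ℕ) : Prop :=
  ∃ S : Set V, S.ncard = m ∧ TopSet k S ∧ (∀ v ∈ S, 2 ≤ k v) ∧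
    SimpleGraphical (fun v : V => if v ∈ S then k v - 2 else k v)

/-- `m` is `m*`, the maximum `m` for which the sequence is `m`-simple-graphical. -/
def IsMStar (k : V → ℕ) (m : ℕ) : Prop :=
  MSimpleGraphical k m ∧ ∀ m' : ℕ, MSimpleGraphical k m' → m' ≤ m

/-- `G` is `m`-loopy: it has self-loops exactly at `m` highest-degree vertices. -/
def MLoopy (G : LoopyGraph V) (m : ℕ) : Prop :=
  (selfLoops G).ncard = m ∧ TopSet (deg G) (selfLoops G)

end LoopyGraph

namespace LoopyGraph

variable {V : Type}

/-- The graph obtained from `G` by replacing the edges `(u,v)`, `(x,y)` by `(u,x)`, `(v,y)`. -/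
def swap (G : LoopyGraph V) (u v x y : V) : LoopyGraph V where
  Adj a b := (G.Adj a b ∧ s(a, b) ≠ s(u, v) ∧ s(a, b) ≠ s(x, y)) ∨
    s(a, b) = s(u, x) ∨ s(a, b) = s(v, y)
  symm a b h := by
    rw [Sym2.eq_swap (a := b) (b := a)]
    exact h.imp_left fun h => ⟨G.symm _ _ h.1, h.2⟩

theorem doubleEdgeSwap_swap {G : LoopyGraph V} {u v x y : V} (huv : G.Adj u v)
    (hxy : G.Adj x y) (hne : s(u, v) ≠ s(x, y)) (hux : ¬ G.Adj u x) (hvy : ¬ G.Adj v y)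
    (hne' : s(u, x) ≠ s(v, y)) : DoubleEdgeSwap G (G.swap u v x y) :=
  ⟨u, v, x, y, huv, hxy, hne, hux, hvy, hne', fun _ _ => Iff.rfl⟩

/-- If a graph with the same self-loops as a swap-maximal `G` is reachable from it, then in that
graph any two distinct neighbors of a vertex without self-loop are adjacent. -/
theorem SwapMaximal.adj_of_adj_of_adj [Finite V] {G H : LoopyGraph V} (hG : G.SwapMaximal)
    (hGH : Reach G H) (hloops : ∀ a, H.Adj a a ↔ G.Adj a a) {x v y : V} (hx : ¬ G.Adj x x)
    (hv : H.Adj x v) (hy : H.Adj x y) (hvy : v ≠ y) : H.Adj v y := by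
  by_contra hn
  have hxx : ¬ H.Adj x x := fun h => hx ((hloops x).1 h)
  have hxv : x ≠ v := by rintro rfl; exact hxx hv
  have hxy : x ≠ y := by rintro rfl; exact hxx hy
  have hswap : DoubleEdgeSwap H (H.swap x v x y) :=
    doubleEdgeSwap_swap hv hy (by grind [Sym2.eq_iff]) hxx hn (by grind [Sym2.eq_iff])
  have hle := (hG _ (hGH.tail hswap)).1
  have hlt : (selfLoops G).ncard < (selfLoops (H.swap x v x y)).ncard := by
    refine Set.ncard_lt_ncard ⟨fun a ha => ?_, fun h => hx (h ?_)⟩ (Set.toFinite _)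
    · exact Or.inl ⟨(hloops a).2 ha, by grind [Sym2.eq_iff], by grind [Sym2.eq_iff]⟩
    · exact Or.inr (Or.inl rfl)
  omega

theorem SwapMaximal.adj_of_adj [Finite V] {G : LoopyGraph V} (hG : G.SwapMaximal) {x v y : V}
    (hx : ¬ G.Adj x x) (hv : G.Adj x v) (hy : G.Adj x y) (hvy : v ≠ y) : G.Adj v y :=
  hG.adj_of_adj_of_adj Relation.ReflTransGen.refl (fun _ => Iff.rfl) hx hv hy hvy

/-- In a swap-maximal graph, an endpoint `u` of an edge inside `V^0` has at least as many
neighbors as any vertex of `V^0`. -/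
theorem SwapMaximal.ncard_nbr_le [Finite V] {G : LoopyGraph V} (hG : G.SwapMaximal) {u v x : V}
    (hu : ¬ G.Adj u u) (hv : ¬ G.Adj v v) (hx : ¬ G.Adj x x) (huv : G.Adj u v) :
    (G.nbr x).ncard ≤ (G.nbr u).ncard := by
  by_contra! hlt
  have huv' : u ≠ v := by rintro rfl; exact hu huv
  have hvu := G.symm _ _ huv
  have hxu' : x ≠ u := by rintro rfl; exact hlt.false
  have hxu : ¬ G.Adj x u := by
    intro hxu
    have hle : (G.nbr x \ {u}).ncard ≤ (G.nbr u \ {x}).ncard := by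
      refine Set.ncard_le_ncard (fun w hw => ?_) (Set.toFinite _)
      obtain ⟨⟨hwx, hxw⟩, hwu⟩ := hw
      exact ⟨⟨hwu, hG.adj_of_adj hx hxu hxw (Ne.symm hwu)⟩, hwx⟩
    have h₁ := Set.ncard_sdiff_singleton_add_one (show u ∈ G.nbr x from ⟨hxu'.symm, hxu⟩)
      (Set.toFinite _)
    have h₂ := Set.ncard_sdiff_singleton_add_one
      (show x ∈ G.nbr u from ⟨hxu', G.symm _ _ hxu⟩) (Set.toFinite _)
    omega
  have hxv' : x ≠ v := by rintro rfl; exact hxu hvu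
  have hxv : ¬ G.Adj x v := fun h =>
    hxu (hG.adj_of_adj hv (G.symm _ _ h) hvu hxu')
  have hone : 1 < (G.nbr x \ G.nbr u).ncard := by
    have hpos : 0 < (G.nbr u \ G.nbr x).ncard :=
      (Set.ncard_pos (Set.toFinite _)).2 ⟨v, ⟨huv'.symm, huv⟩, fun h => hxv h.2⟩
    have h₁ := Set.ncard_inter_add_ncard_sdiff_eq_ncard (G.nbr x) (G.nbr u) (Set.toFinite _)
    have h₂ := Set.ncard_inter_add_ncard_sdiff_eq_ncard (G.nbr u) (G.nbr x) (Set.toFinite _)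
    rw [Set.inter_comm] at h₂
    omega
  obtain ⟨w, z, ⟨⟨hwx, hxw⟩, hwu⟩, ⟨⟨hzx, hxz⟩, hzu⟩, hwz⟩ :=
    (Set.one_lt_ncard_iff (Set.toFinite _)).1 hone
  have hwu' : w ≠ u := by rintro rfl; exact hxu hxw
  have hzu' : z ≠ u := by rintro rfl; exact hxu hxz
  have hwv' : w ≠ v := by rintro rfl; exact hxv hxw
  have hzv' : z ≠ v := by rintro rfl; exact hxv hxz
  have hvw : ¬ G.Adj v w := fun h => hwu ⟨hwu', hG.adj_of_adj hv hvu h hwu'.symm⟩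
  have hswap : DoubleEdgeSwap G (G.swap u v x w) :=
    doubleEdgeSwap_swap huv hxw (by grind [Sym2.eq_iff]) (fun h => hxu (G.symm _ _ h)) hvw
      (by grind [Sym2.eq_iff])
  have huz : (G.swap u v x w).Adj u z := by
    refine hG.adj_of_adj_of_adj (Relation.ReflTransGen.single hswap) (fun a => ?_) hx
      (Or.inr (Or.inl Sym2.eq_swap)) (Or.inl ⟨hxz, ?_, ?_⟩) hzu'.symm
    · simp only [swap]; grind [Sym2.eq_iff]
    · grind [Sym2.eq_iff]
    · grind [Sym2.eq_iff]
  rcases huz with h | h | h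
  · exact hzu ⟨hzu', h.1⟩
  · grind [Sym2.eq_iff]
  · grind [Sym2.eq_iff]

end LoopyGraph

/-- In a swap-maximal loopy graph `Ĝ^d` with `d ≥ 2`, every vertex of `K^0`
has degree at least that of every vertex of `V^0`. -/
theorem swap_maximal_K0_max_degree_in_V0 {V : Type} [Fintype V] (G : LoopyGraph V)
    (hmax : G.SwapMaximal) (K : Set V) (d : ℕ) (hd : 2 ≤ d)
    (hK : LoopyGraph.LargestV0Clique G K d) :
    ∀ u ∈ K, ∀ x ∈ LoopyGraph.Vset G 0, G.deg x ≤ G.deg u := by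
  intro u hu x hx
  obtain ⟨hK0, hclique, hcard, -⟩ := hK
  obtain ⟨v, hv, hvu⟩ := Set.exists_ne_of_one_lt_ncard (show 1 < K.ncard by omega) u
  have hu0 : ¬ G.Adj u u := hK0 hu
  have hx0 : ¬ G.Adj x x := hx
  simpa [LoopyGraph.deg, hu0, hx0] using
    hmax.ncard_nbr_le hu0 (hK0 hv) hx0 (hclique u hu v hv hvu.symm)
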